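/- arXiv:1503.03360 — 2 statements merged into one kernel-verified Lean document; each statement's English description precedes it below -/
import Mathlib

section
/- Every aperiodic homeomorphism T of a Cantor space X admits a basic set: a closed nonempty subset Y of X such that Y ∩ T^i(Y) = ∅ for every integer i ≠ 0, and every clopen neighborhood of Y meets every T-orbit. -/
/-- A set `B` is `n`-separated under `f` if no point of `B` returns to `B` in at most `n` steps,
forwards or backwards. -/
def IsSeparatedUpTo {X : Type*} (f : Equiv.Perm X) (n : ℕ) (B : Set X) : Prop :=
  ∀ x ∈ B, ∀ i ∈ Finset.Icc (-n : ℤ) n, i ≠ 0 → (f ^ i) x ∉ B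

theorem Homeomorph.continuous_toEquiv_zpow {X : Type*} [TopologicalSpace X] (T : X ≃ₜ X) (i : ℤ) :
    Continuous (T.toEquiv ^ i : Equiv.Perm X) := by
  have key : ∀ n : ℕ, Continuous (T.toEquiv ^ n : Equiv.Perm X) ∧
      Continuous ((T.toEquiv ^ n : Equiv.Perm X)⁻¹ : Equiv.Perm X) := by
    intro n
    induction n with
    | zero => exact ⟨continuous_id, continuous_id⟩
    | succ n ih =>
      constructor
      · rw [pow_succ]
        exact ih.1.comp T.continuous
      · rw [pow_succ', mul_inv_rev]
        exact ih.2.comp T.symm.continuous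
  obtain ⟨n, rfl | rfl⟩ := i.eq_nat_or_neg
  · simpa using (key n).1
  · simpa using (key n).2

theorem Equiv.Perm.finite_range_zpow_apply {X : Type*} (f : Equiv.Perm X) {i : ℤ} (hi : i ≠ 0)
    {x : X} (h : (f ^ i) x = x) : (Set.range fun n : ℤ => (f ^ n) x).Finite := by
  refine ((Set.finite_Ico (0 : ℤ) |i|).image fun n : ℤ => (f ^ n) x).subset ?_
  rintro _ ⟨n, rfl⟩
  refine ⟨n % i, ⟨Int.emod_nonneg n hi, Int.emod_lt_abs n hi⟩, ?_⟩
  have hn : f ^ n = f ^ (n % i) * (f ^ i) ^ (n / i) := by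
    rw [← zpow_mul, ← zpow_add, Int.emod_add_mul_ediv]
  simp only [hn, Equiv.Perm.mul_apply]
  rw [Equiv.Perm.zpow_apply_eq_self_of_apply_eq_self h]

theorem exists_isClopen_isSeparatedUpTo_mem {X : Type*} [TopologicalSpace X] [CompactSpace X]
    [T2Space X] [TotallyDisconnectedSpace X] {f : Equiv.Perm X}
    (hf : ∀ i : ℤ, Continuous (f ^ i : Equiv.Perm X)) {x : X}
    (hx : ∀ i : ℤ, i ≠ 0 → (f ^ i) x ≠ x) (n : ℕ) :
    ∃ U : Set X, IsClopen U ∧ x ∈ U ∧ IsSeparatedUpTo f n U := by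
  have h : ∀ i : ℤ, ∃ C : Set X, IsClopen C ∧ x ∈ C ∧ (i ≠ 0 → ∀ y ∈ C, (f ^ i) y ∉ C) := by
    intro i
    by_cases hi : i = 0
    · exact ⟨Set.univ, isClopen_univ, trivial, fun h => absurd hi h⟩
    · obtain ⟨C, hC, hxC, hiC⟩ := exists_isClopen_of_totally_separated (hx i hi).symm
      exact ⟨C ∩ (f ^ i) ⁻¹' Cᶜ, hC.inter (hC.compl.preimage (hf i)), ⟨hxC, hiC⟩,
        fun _ y hy hy' => hy.2 hy'.1⟩
  choose C hC hxC hsep using h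
  refine ⟨⋂ i ∈ Finset.Icc (-n : ℤ) n, C i, isClopen_biInter_finset fun i _ => hC i,
    Set.mem_iInter₂.2 fun i _ => hxC i, fun y hy i hi hi0 hy' => ?_⟩
  exact hsep i hi0 y (Set.mem_iInter₂.1 hy i hi) (Set.mem_iInter₂.1 hy' i hi)

/-- A clopen separated set can be enlarged within `C ∪ U`, for `U` clopen and separated, so that
the orbit of every point of `U` meets it. -/
theorem IsSeparatedUpTo.exists_isClopen_superset {X : Type*} [TopologicalSpace X]
    {f : Equiv.Perm X} (hf : ∀ i : ℤ, Continuous (f ^ i : Equiv.Perm X)) {n : ℕ} {C U : Set X}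
    (hCs : IsSeparatedUpTo f n C) (hC : IsClopen C)
    (hUs : IsSeparatedUpTo f n U) (hU : IsClopen U) :
    ∃ B : Set X, IsClopen B ∧ IsSeparatedUpTo f n B ∧ C ⊆ B ∧ B ⊆ C ∪ U ∧
      ∀ x ∈ U, ∃ i : ℤ, (f ^ i) x ∈ B := by
  set W : Set X := ⋃ i ∈ Finset.Icc (-n : ℤ) n, (f ^ i) ⁻¹' C with hW
  have hWc : IsClopen W := isClopen_biUnion_finset fun i _ => hC.preimage (hf i)
  refine ⟨C ∪ U \ W, hC.union (hU.diff hWc), ?_, Set.subset_union_left,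
    Set.union_subset_union_right _ Set.sdiff_subset, ?_⟩
  · rintro x (hx | hx) i hi hi0 (hx' | hx')
    · exact hCs x hx i hi hi0 hx'
    · refine hx'.2 (Set.mem_iUnion₂.2 ⟨-i, ?_, ?_⟩)
      · rw [Finset.mem_Icc] at hi ⊢
        lia
      · simpa using hx
    · exact hx.2 (Set.mem_iUnion₂.2 ⟨i, hi, hx'⟩)
    · exact hUs x hx.1 i hi hi0 hx'.1
  · intro x hx
    by_cases hxW : x ∈ W
    · obtain ⟨i, _, hi⟩ := Set.mem_iUnion₂.1 hxW
      exact ⟨i, Or.inl hi⟩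
    · exact ⟨0, Or.inr ⟨hx, hxW⟩⟩

/-- Every clopen set contains a clopen `n`-separated set meeting the orbits of all its points. -/
theorem exists_isClopen_isSeparatedUpTo_subset {X : Type*} [TopologicalSpace X] [CompactSpace X]
    [T2Space X] [TotallyDisconnectedSpace X] {f : Equiv.Perm X}
    (hf : ∀ i : ℤ, Continuous (f ^ i : Equiv.Perm X))
    (hfree : ∀ x : X, ∀ i : ℤ, i ≠ 0 → (f ^ i) x ≠ x) (n : ℕ) {A : Set X} (hA : IsClopen A) :
    ∃ B : Set X, IsClopen B ∧ IsSeparatedUpTo f n B ∧ B ⊆ A ∧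
      ∀ x ∈ A, ∃ i : ℤ, (f ^ i) x ∈ B := by
  have key : ∀ C : Set X, IsClopen C → IsSeparatedUpTo f n C → ∃ B : Set X, IsClopen B ∧
      IsSeparatedUpTo f n B ∧ C ⊆ B ∧ B ⊆ C ∪ A ∧ ∀ x ∈ A, ∃ i : ℤ, (f ^ i) x ∈ B := by
    refine hA.isClosed.isCompact.induction_on (p := fun s => ∀ C : Set X, IsClopen C →
      IsSeparatedUpTo f n C → ∃ B : Set X, IsClopen B ∧
      IsSeparatedUpTo f n B ∧ C ⊆ B ∧ B ⊆ C ∪ A ∧ ∀ x ∈ s, ∃ i : ℤ, (f ^ i) x ∈ B) ?_ ?_ ?_ ?_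
    · exact fun C hC hCs => ⟨C, hC, hCs, subset_rfl, Set.subset_union_left, by simp⟩
    · intro s t hst ht C hC hCs
      obtain ⟨B, hB, hBs, hCB, hBA, hmeet⟩ := ht C hC hCs
      exact ⟨B, hB, hBs, hCB, hBA, fun x hx => hmeet x (hst hx)⟩
    · intro s t hs ht C hC hCs
      obtain ⟨B, hB, hBs, hCB, hBA, hBm⟩ := hs C hC hCs
      obtain ⟨D, hD, hDs, hBD, hDA, hDm⟩ := ht B hB hBs
      refine ⟨D, hD, hDs, hCB.trans hBD,
        hDA.trans (Set.union_subset hBA Set.subset_union_right), ?_⟩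
      rintro x (hx | hx)
      · exact (hBm x hx).imp fun i hi => hBD hi
      · exact hDm x hx
    · intro x hx
      obtain ⟨U, hU, hxU, hUs⟩ := exists_isClopen_isSeparatedUpTo_mem hf (hfree x) n
      refine ⟨U ∩ A, mem_nhdsWithin_of_mem_nhds ((hU.inter hA).isOpen.mem_nhds ⟨hxU, hx⟩), ?_⟩
      intro C hC hCs
      obtain ⟨B, hB, hBs, hCB, hBU, hm⟩ := hCs.exists_isClopen_superset hf hC
        (fun y hy i hi hi0 hy' => hUs y hy.1 i hi hi0 hy'.1) (hU.inter hA)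
      exact ⟨B, hB, hBs, hCB,
        hBU.trans (Set.union_subset_union_right _ Set.inter_subset_right), hm⟩
  obtain ⟨B, hB, hBs, _, hBA, hm⟩ := key ∅ isClopen_empty fun x hx => hx.elim
  exact ⟨B, hB, hBs, by simpa using hBA, hm⟩

/-- A decreasing sequence of clopen sets meeting every orbit, the `n`-th one being
`n`-separated. -/
theorem exists_antitone_isClopen_isSeparatedUpTo {X : Type*} [TopologicalSpace X] [CompactSpace X]
    [T2Space X] [TotallyDisconnectedSpace X] {f : Equiv.Perm X}
    (hf : ∀ i : ℤ, Continuous (f ^ i : Equiv.Perm X))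
    (hfree : ∀ x : X, ∀ i : ℤ, i ≠ 0 → (f ^ i) x ≠ x) :
    ∃ B : ℕ → Set X, Antitone B ∧ ∀ n, IsClopen (B n) ∧ IsSeparatedUpTo f n (B n) ∧
      ∀ x, ∃ i : ℤ, (f ^ i) x ∈ B n := by
  have step : ∀ (n : ℕ) (A : {A : Set X // IsClopen A ∧ ∀ x, ∃ i : ℤ, (f ^ i) x ∈ A}),
      ∃ B : {A : Set X // IsClopen A ∧ ∀ x, ∃ i : ℤ, (f ^ i) x ∈ A},
        B.1 ⊆ A.1 ∧ IsSeparatedUpTo f n B.1 := by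
    rintro n ⟨A, hA, hAm⟩
    obtain ⟨B, hB, hBs, hBA, hm⟩ := exists_isClopen_isSeparatedUpTo_subset hf hfree n hA
    refine ⟨⟨B, hB, fun x => ?_⟩, hBA, hBs⟩
    obtain ⟨i, hi⟩ := hAm x
    obtain ⟨j, hj⟩ := hm _ hi
    exact ⟨j + i, by rwa [zpow_add, Equiv.Perm.mul_apply]⟩
  choose next hsub hsep using step
  let B : ℕ → {A : Set X // IsClopen A ∧ ∀ x, ∃ i : ℤ, (f ^ i) x ∈ A} :=
    fun n => n.rec ⟨Set.univ, isClopen_univ, fun _ => ⟨0, trivial⟩⟩ next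
  exact ⟨fun n => (B (n + 1)).1, antitone_nat_of_succ_le fun n => hsub (n + 1) (B (n + 1)),
    fun n => ⟨(B (n + 1)).2.1, hsep n (B n), (B (n + 1)).2.2⟩⟩

/-- **Existence of basic sets.** Every aperiodic homeomorphism `T` of a Cantor space `X`
admits a basic set: a closed nonempty subset `Y ⊆ X` such that `Y ∩ T^i(Y) = ∅` for every
integer `i ≠ 0`, and every clopen neighborhood of `Y` meets every `T`-orbit. -/
theorem exists_basic_set
    (X : Type) [TopologicalSpace X] [CompactSpace X]
    [TopologicalSpace.MetrizableSpace X] [TotallyDisconnectedSpace X]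
    [PerfectSpace X] [Nonempty X]
    (T : X ≃ₜ X)
    (haper : ∀ x : X, (Set.range fun n : ℤ => (T.toEquiv ^ n) x).Infinite) :
    ∃ Y : Set X, Y.Nonempty ∧ IsClosed Y ∧
      (∀ i : ℤ, i ≠ 0 → Y ∩ ((T.toEquiv ^ i : Equiv.Perm X) '' Y) = ∅) ∧
      (∀ A : Set X, IsClopen A → Y ⊆ A → ∀ x : X, ∃ n : ℤ, (T.toEquiv ^ n) x ∈ A) := by
  have hf := T.continuous_toEquiv_zpow
  have hfree : ∀ x : X, ∀ i : ℤ, i ≠ 0 → (T.toEquiv ^ i : Equiv.Perm X) x ≠ x :=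
    fun x i hi h => haper x (Equiv.Perm.finite_range_zpow_apply T.toEquiv hi h)
  obtain ⟨B, hanti, hB⟩ := exists_antitone_isClopen_isSeparatedUpTo hf hfree
  have hdir : Directed (· ⊇ ·) B := hanti.directed_ge
  refine ⟨⋂ n, B n, ?_, isClosed_iInter fun n => (hB n).1.isClosed, ?_, ?_⟩
  · refine IsCompact.nonempty_iInter_of_directed_nonempty_isCompact_isClosed B hdir
      (fun n => ?_) (fun n => (hB n).1.isClosed.isCompact) (fun n => (hB n).1.isClosed)
    obtain ⟨i, hi⟩ := (hB n).2.2 (Classical.arbitrary X)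
    exact ⟨_, hi⟩
  · intro i hi
    rw [Set.eq_empty_iff_forall_notMem]
    rintro _ ⟨hy, x, hx, rfl⟩
    refine (hB i.natAbs).2.1 x (Set.mem_iInter.1 hx _) i ?_ hi (Set.mem_iInter.1 hy _)
    rw [Finset.mem_Icc]
    lia
  · intro A hA hYA x
    obtain ⟨n, hn⟩ := exists_subset_nhds_of_isCompact hdir
      (fun n => (hB n).1.isClosed.isCompact) fun y hy => hA.isOpen.mem_nhds (hYA hy)
    exact ((hB n).2.2 x).imp fun i hi => hn hi
end

section
/- Let (X,T) be an aperiodic Cantor dynamical system with a basic set Y. Then there exist an ordered Bratteli diagram (B, ω) whose order ω is perfect and a homeomorphism h : X → X_B such that h ∘ T = φ_ω ∘ h, where φ_ω is the Vershik map of (B, ω), and h(Y) = X_min(ω), the set of ω-minimal infinite paths. -/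
open MeasureTheory

/-- A Bratteli diagram. -/
structure BratteliDiagram where
  V : ℕ → Type
  E : ℕ → Type
  fintypeV : ∀ n, Fintype (V n)
  fintypeE : ∀ n, Fintype (E n)
  nonemptyV : ∀ n, Nonempty (V n)
  nonemptyE : ∀ n, Nonempty (E n)
  root_subsingleton : ∀ v w : V 0, v = w
  src : ∀ n, E n → V n
  rng : ∀ n, E n → V (n + 1)
  src_surj : ∀ n, Function.Surjective (src n)
  rng_surj : ∀ n, Function.Surjective (rng n)

attribute [instance] BratteliDiagram.fintypeV BratteliDiagram.fintypeE
  BratteliDiagram.nonemptyV BratteliDiagram.nonemptyE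

namespace BratteliDiagram

variable (B : BratteliDiagram)

instance (n : ℕ) : TopologicalSpace (B.E n) := ⊥

/-- The path space `X_B` of a Bratteli diagram. -/
def PathSpace : Type :=
  { x : ∀ n, B.E n // ∀ n, B.rng n (x n) = B.src (n + 1) (x (n + 1)) }

instance : TopologicalSpace B.PathSpace := by unfold PathSpace; infer_instance

noncomputable instance : MeasurableSpace B.PathSpace := borel _

/-- The vertex at level `n` through which a path passes. -/
def endVtx (n : ℕ) (x : B.PathSpace) : B.V n := B.src n (x.1 n)

/-- The cylinder set of paths agreeing with `x` on the first `n` edges. -/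
def cyl (n : ℕ) (x : B.PathSpace) : Set B.PathSpace := { y | ∀ i < n, y.1 i = x.1 i }

/-- Tail equivalence of paths. -/
def tailEq (x y : B.PathSpace) : Prop := ∃ N, ∀ n, N ≤ n → x.1 n = y.1 n

/-- The tail equivalence relation is aperiodic: all classes are infinite. -/
def TailAperiodic : Prop := ∀ x : B.PathSpace, { y | B.tailEq x y }.Infinite

/-- A measure is invariant for the tail equivalence relation if any two
cylinder sets ending at the same vertex have equal measure. -/
def TailInvariant (μ : Measure B.PathSpace) : Prop :=
  ∀ (n : ℕ) (x y : B.PathSpace), B.endVtx n x = B.endVtx n y →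
    μ (B.cyl n x) = μ (B.cyl n y)

/-- Ergodicity with respect to the tail equivalence relation. -/
def TailErgodic (μ : Measure B.PathSpace) : Prop :=
  ∀ S : Set B.PathSpace, MeasurableSet S →
    (∀ x y, B.tailEq x y → (x ∈ S ↔ y ∈ S)) → μ S = 0 ∨ μ Sᶜ = 0

/-- The type of finite paths from the root vertex to `v`. -/
def FinPathTo : ∀ n, B.V n → Type
  | 0, _ => PUnit
  | n + 1, v => Σ e : { e : B.E n // B.rng n e = v }, FinPathTo n (B.src n e.1)

/-- The height `h_v^{(n)}`: the number of finite paths from the root to `v`. -/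
noncomputable def height (n : ℕ) (v : B.V n) : ℕ := Nat.card (B.FinPathTo n v)

/-- The number of edges from `w ∈ V_n` to `v ∈ V_{n+1}`; the entry `f^{(n)}_{v,w}`
of the incidence matrix `F_n`. -/
noncomputable def edgeCount (n : ℕ) (v : B.V (n + 1)) (w : B.V n) : ℕ :=
  Nat.card { e : B.E n // B.rng n e = v ∧ B.src n e = w }

/-- The incidence matrix `F_n`, as a real matrix. -/
noncomputable def incMat (n : ℕ) : Matrix (B.V (n + 1)) (B.V n) ℝ :=
  fun v w => (B.edgeCount n v w : ℝ)

end BratteliDiagram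
namespace BratteliDiagram

variable {B : BratteliDiagram}

/-- An order on a Bratteli diagram: a linear order on each set `r^{-1}(v)`. -/
def OrderOn (B : BratteliDiagram) : Type :=
  ∀ (n : ℕ) (v : B.V (n + 1)), LinearOrder { e : B.E n // B.rng n e = v }

/-- An edge is maximal if it is the largest element of `r^{-1}(r(e))`. -/
def IsMaxEdge (ω : B.OrderOn) {n : ℕ} (e : B.E n) : Prop :=
  ∀ e' : { e' : B.E n // B.rng n e' = B.rng n e }, (ω n (B.rng n e)).le e' ⟨e, rfl⟩

/-- An edge is minimal if it is the smallest element of `r^{-1}(r(e))`. -/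
def IsMinEdge (ω : B.OrderOn) {n : ℕ} (e : B.E n) : Prop :=
  ∀ e' : { e' : B.E n // B.rng n e' = B.rng n e }, (ω n (B.rng n e)).le ⟨e, rfl⟩ e'

/-- A maximal infinite path. -/
def IsMaxPath (ω : B.OrderOn) (x : B.PathSpace) : Prop := ∀ n, IsMaxEdge ω (x.1 n)

/-- A minimal infinite path. -/
def IsMinPath (ω : B.OrderOn) (x : B.PathSpace) : Prop := ∀ n, IsMinEdge ω (x.1 n)

/-- `e'` is the successor of `e` in the linearly ordered set `r^{-1}(r(e))`. -/
def IsSuccEdge (ω : B.OrderOn) {n : ℕ} (e e' : B.E n) : Prop :=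
  ∃ h : B.rng n e' = B.rng n e,
    (ω n (B.rng n e)).lt ⟨e, rfl⟩ ⟨e', h⟩ ∧
      ∀ f : { f : B.E n // B.rng n f = B.rng n e },
        (ω n (B.rng n e)).lt ⟨e, rfl⟩ f → (ω n (B.rng n e)).le ⟨e', h⟩ f

/-- `φ` is a (continuous) Vershik map for the ordered Bratteli diagram `(B, ω)`. -/
def IsVershikMap (ω : B.OrderOn) (φ : B.PathSpace ≃ₜ B.PathSpace) : Prop :=
  ((φ : B.PathSpace → B.PathSpace) '' { x | IsMaxPath ω x } = { x | IsMinPath ω x }) ∧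
    ∀ x : B.PathSpace, ¬IsMaxPath ω x →
      ∃ k : ℕ, (∀ i < k, IsMaxEdge ω (x.1 i)) ∧ ¬IsMaxEdge ω (x.1 k) ∧
        IsSuccEdge ω (x.1 k) ((φ x).1 k) ∧
        (∀ i < k, IsMinEdge ω ((φ x).1 i)) ∧
        ∀ i, k < i → (φ x).1 i = x.1 i

/-- An order is perfect if it admits a Vershik map. -/
def PerfectOrder (ω : B.OrderOn) : Prop := ∃ φ : B.PathSpace ≃ₜ B.PathSpace, IsVershikMap ω φ

end BratteliDiagram

section EntryTime

variable {X : Type} [TopologicalSpace X] (T : X ≃ₜ X)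

/-- The least number of backward steps along `T` needed to reach `A`. -/
noncomputable def entryTime (A : Set X) (x : X) : ℕ := sInf { m | T.symm^[m] x ∈ A }

/-- The first point of `A` met on the backward orbit of `x`. -/
noncomputable def entryPoint (A : Set X) (x : X) : X := T.symm^[entryTime T A x] x

variable {T} {A A' : Set X}

lemma iterate_iterate_symm (m : ℕ) (x : X) : T^[m] (T.symm^[m] x) = x :=
  Function.LeftInverse.iterate (g := T) (f := T.symm) T.apply_symm_apply m x

lemma iterate_symm_iterate (m : ℕ) (x : X) : T.symm^[m] (T^[m] x) = x :=
  Function.LeftInverse.iterate (g := T.symm) (f := T) T.symm_apply_apply m x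

lemma iterate_symm_succ_apply (m : ℕ) (x : X) : T.symm^[m + 1] (T x) = T.symm^[m] x := by
  rw [Function.iterate_succ_apply, T.symm_apply_apply]

lemma iterate_symm_iterate_of_le {m n : ℕ} (h : m ≤ n) (x : X) :
    T.symm^[m] (T^[n] x) = T^[n - m] x := by
  obtain ⟨k, rfl⟩ := Nat.exists_eq_add_of_le h
  rw [Function.iterate_add_apply, iterate_symm_iterate, Nat.add_sub_cancel_left]

lemma entryPoint_mem (hA : ∀ x, ∃ m : ℕ, T.symm^[m] x ∈ A) (x : X) : entryPoint T A x ∈ A :=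
  Nat.sInf_mem (hA x)

lemma entryTime_le {m : ℕ} {x : X} (h : T.symm^[m] x ∈ A) : entryTime T A x ≤ m :=
  Nat.sInf_le h

lemma entryTime_eq_zero_of_mem {x : X} (h : x ∈ A) : entryTime T A x = 0 :=
  Nat.le_zero.mp (entryTime_le (m := 0) h)

lemma entryTime_eq_zero_iff (hA : ∀ x, ∃ m : ℕ, T.symm^[m] x ∈ A) {x : X} :
    entryTime T A x = 0 ↔ x ∈ A := by
  refine ⟨fun h => ?_, entryTime_eq_zero_of_mem⟩
  have := entryPoint_mem hA x
  rwa [entryPoint, h] at this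

lemma iterate_entryTime_entryPoint (x : X) : T^[entryTime T A x] (entryPoint T A x) = x :=
  iterate_iterate_symm _ _

lemma entryPoint_of_mem {x : X} (h : x ∈ A) : entryPoint T A x = x := by
  rw [entryPoint, entryTime_eq_zero_of_mem h, Function.iterate_zero_apply]

lemma entryPoint_iterate {y : X} {m : ℕ} (h : entryTime T A (T^[m] y) = m) :
    entryPoint T A (T^[m] y) = y := by
  rw [entryPoint, h, iterate_symm_iterate]

lemma entryTime_le_of_subset (hA' : ∀ x, ∃ m : ℕ, T.symm^[m] x ∈ A') (h : A' ⊆ A) (x : X) :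
    entryTime T A x ≤ entryTime T A' x :=
  entryTime_le (h (entryPoint_mem hA' x))

lemma entryTime_entryPoint_add (hA' : ∀ x, ∃ m : ℕ, T.symm^[m] x ∈ A') (h : A' ⊆ A) (x : X) :
    entryTime T A' (entryPoint T A x) + entryTime T A x = entryTime T A' x := by
  have hle := entryTime_le_of_subset hA' h x
  apply le_antisymm
  · have : entryTime T A' (entryPoint T A x) ≤ entryTime T A' x - entryTime T A x := by
      apply entryTime_le
      rw [entryPoint, ← Function.iterate_add_apply, Nat.sub_add_cancel hle]
      exact entryPoint_mem hA' x
    omega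
  · apply entryTime_le
    rw [Function.iterate_add_apply]
    exact entryPoint_mem hA' _

lemma entryPoint_entryPoint (hA' : ∀ x, ∃ m : ℕ, T.symm^[m] x ∈ A') (h : A' ⊆ A) (x : X) :
    entryPoint T A' (entryPoint T A x) = entryPoint T A' x := by
  conv_rhs => rw [entryPoint, ← entryTime_entryPoint_add hA' h x, Function.iterate_add_apply]
  rfl

lemma entryTime_apply_of_notMem (hA : ∀ x, ∃ m : ℕ, T.symm^[m] x ∈ A) {x : X} (h : T x ∉ A) :
    entryTime T A (T x) = entryTime T A x + 1 := by
  apply le_antisymm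
  · apply entryTime_le
    rw [iterate_symm_succ_apply]
    exact entryPoint_mem hA x
  · have hne : entryTime T A (T x) ≠ 0 := fun h0 => h ((entryTime_eq_zero_iff hA).1 h0)
    obtain ⟨m, hm⟩ := Nat.exists_eq_succ_of_ne_zero hne
    have := entryPoint_mem hA (T x)
    rw [entryPoint, hm, Nat.succ_eq_add_one, iterate_symm_succ_apply] at this
    rw [hm]
    exact Nat.succ_le_succ (entryTime_le this)

lemma entryPoint_apply_of_notMem (hA : ∀ x, ∃ m : ℕ, T.symm^[m] x ∈ A) {x : X} (h : T x ∉ A) :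
    entryPoint T A (T x) = entryPoint T A x := by
  rw [entryPoint, entryTime_apply_of_notMem hA h, iterate_symm_succ_apply, entryPoint]

lemma continuous_iterate_symm (m : ℕ) : Continuous (T.symm^[m]) :=
  T.symm.continuous.iterate m

lemma isLocallyConstant_entryTime (hclopen : IsClopen A)
    (hA : ∀ x, ∃ m : ℕ, T.symm^[m] x ∈ A) : IsLocallyConstant (entryTime T A) := by
  rw [IsLocallyConstant.iff_eventually_eq]
  intro x
  have hin : ∀ᶠ y in nhds x, T.symm^[entryTime T A x] y ∈ A :=
    (continuous_iterate_symm _).continuousAt.eventually_mem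
      (hclopen.isOpen.mem_nhds (entryPoint_mem hA x))
  have hout : ∀ᶠ y in nhds x, ∀ i ∈ Finset.range (entryTime T A x), T.symm^[i] y ∈ Aᶜ := by
    rw [Filter.eventually_all_finset]
    intro i hi
    refine (continuous_iterate_symm _).continuousAt.eventually_mem
      (hclopen.compl.isOpen.mem_nhds fun hmem => ?_)
    exact absurd (entryTime_le hmem) (not_le.2 (Finset.mem_range.1 hi))
  filter_upwards [hin, hout] with y hy hy'
  refine le_antisymm (entryTime_le hy) (not_lt.1 fun hlt => ?_)
  exact hy' _ (Finset.mem_range.2 hlt) (entryPoint_mem hA y)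

lemma isLocallyConstant_entryPoint {α : Type*} {f : X → α} (hf : IsLocallyConstant f)
    (hclopen : IsClopen A) (hA : ∀ x, ∃ m : ℕ, T.symm^[m] x ∈ A) :
    IsLocallyConstant fun x => f (entryPoint T A x) := by
  rw [IsLocallyConstant.iff_eventually_eq]
  intro x
  filter_upwards [(isLocallyConstant_entryTime hclopen hA).eventually_eq x,
    (hf.comp_continuous (continuous_iterate_symm (entryTime T A x))).eventually_eq x] with y h1 h2
  rw [entryPoint, h1]
  exact h2

/-- A clopen set met by all orbits is met by all backward orbits. -/
lemma exists_iterate_symm_mem [CompactSpace X] (hclopen : IsClopen A)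
    (hA : ∀ x, ∃ n : ℤ, (T.toEquiv ^ n) x ∈ A) (x : X) : ∃ m : ℕ, T.symm^[m] x ∈ A := by
  have hfwd : ∀ (m : ℕ) (z : X), (T.toEquiv ^ (m : ℤ)) z = T^[m] z := fun m z => by
    rw [zpow_natCast, Equiv.Perm.coe_pow]; rfl
  have hbwd : ∀ (m : ℕ) (z : X), (T.toEquiv ^ (-(m : ℤ))) z = T.symm^[m] z := fun m z => by
    rw [zpow_neg, zpow_natCast, ← inv_pow, Equiv.Perm.coe_pow]; rfl
  have hcont : ∀ n : ℤ, Continuous fun z => (T.toEquiv ^ n) z := fun n => by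
    obtain ⟨m, rfl | rfl⟩ := n.eq_nat_or_neg
    · simpa only [hfwd] using T.continuous.iterate m
    · simpa only [hbwd] using T.symm.continuous.iterate m
  obtain ⟨t, ht⟩ := isCompact_univ.elim_finite_subcover
    (fun n : ℤ => (fun z => (T.toEquiv ^ n) z) ⁻¹' A)
    (fun n => hclopen.isOpen.preimage (hcont n))
    (fun z _ => Set.mem_iUnion.2 (hA z))
  obtain ⟨N, hN⟩ : ∃ N : ℕ, ∀ n ∈ t, n ≤ (N : ℤ) :=
    ⟨t.sup Int.toNat, fun n hn => by
      have := Finset.le_sup (f := Int.toNat) hn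
      omega⟩
  obtain ⟨n, hn, hmem⟩ : ∃ n ∈ t, (T.toEquiv ^ n) ((T.toEquiv ^ (-(N : ℤ))) x) ∈ A := by
    simpa using ht (Set.mem_univ ((T.toEquiv ^ (-(N : ℤ))) x))
  refine ⟨(N - n).toNat, ?_⟩
  rw [← Equiv.Perm.mul_apply, ← zpow_add] at hmem
  rw [← hbwd]
  convert hmem using 3
  have := hN n hn
  omega

end EntryTime

/-- A nested sequence of clopen sets, each met by all backward orbits, together with clopen
partitions such that the partition at level `n + 1` determines, along the level `n + 1` towers,
the towers of level `n` and the trace of the `n`-th set of a separating sequence. -/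
structure TowerSystem {X : Type} [TopologicalSpace X] (T : X ≃ₜ X) where
  base : ℕ → Set X
  part : ℕ → DiscreteQuotient X
  sep : ℕ → Set X
  isClopen_base : ∀ n, IsClopen (base n)
  base_zero : base 0 = Set.univ
  base_succ_subset : ∀ n, base (n + 1) ⊆ base n
  visits : ∀ n x, ∃ m : ℕ, T.symm^[m] x ∈ base n
  part_zero : part 0 = ⊤
  separates : ∀ x y, (∀ n, x ∈ sep n ↔ y ∈ sep n) → x = y
  transport : ∀ n x y,
    (part (n + 1)).proj (entryPoint T (base (n + 1)) x) = (part (n + 1)).proj y →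
    entryTime T (base (n + 1)) (T^[entryTime T (base (n + 1)) x] y)
        = entryTime T (base (n + 1)) x ∧
      entryTime T (base n) (T^[entryTime T (base (n + 1)) x] y) = entryTime T (base n) x ∧
      (part n).proj (entryPoint T (base n) (T^[entryTime T (base (n + 1)) x] y))
        = (part n).proj (entryPoint T (base n) x) ∧
      (T^[entryTime T (base (n + 1)) x] y ∈ sep n ↔ x ∈ sep n)

section Refinement

variable {X : Type} [TopologicalSpace X] {T : X ≃ₜ X}

lemma exists_discreteQuotient_determining_iterates {α : Type} {f : X → α}
    (hf : IsLocallyConstant f) (R : ℕ) :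
    ∃ Q : DiscreteQuotient X, ∀ a b, Q.proj a = Q.proj b →
      ∀ i ≤ R, f (T^[i] a) = f (T^[i] b) := by
  let g : Fin (R + 1) → LocallyConstant X α := fun i =>
    ⟨f ∘ T^[i], hf.comp_continuous (T.continuous.iterate i)⟩
  refine ⟨(LocallyConstant.unflip g).discreteQuotient, fun a b hab i hi => ?_⟩
  have h : LocallyConstant.unflip g a = LocallyConstant.unflip g b := Quotient.exact hab
  exact congrFun h ⟨i, Nat.lt_succ_of_le hi⟩

variable [CompactSpace X]

lemma exists_transporting_discreteQuotient {A A' C : Set X} (P : DiscreteQuotient X)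
    (hA : IsClopen A) (hA' : IsClopen A') (hC : IsClopen C)
    (hvA : ∀ x, ∃ m : ℕ, T.symm^[m] x ∈ A) (hvA' : ∀ x, ∃ m : ℕ, T.symm^[m] x ∈ A') :
    ∃ Q : DiscreteQuotient X, ∀ x y, Q.proj (entryPoint T A' x) = Q.proj y →
      entryTime T A' (T^[entryTime T A' x] y) = entryTime T A' x ∧
      entryTime T A (T^[entryTime T A' x] y) = entryTime T A x ∧
      P.proj (entryPoint T A (T^[entryTime T A' x] y)) = P.proj (entryPoint T A x) ∧
      (T^[entryTime T A' x] y ∈ C ↔ x ∈ C) := by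
  have hlc := isLocallyConstant_entryTime hA' hvA'
  obtain ⟨R, hR⟩ := hlc.range_finite.bddAbove
  have hCl : IsLocallyConstant (fun x => x ∈ C) := by
    rw [IsLocallyConstant.iff_eventually_eq]
    intro x
    by_cases hx : x ∈ C
    · filter_upwards [hC.isOpen.mem_nhds hx] with y hy
      simp [hx, hy]
    · filter_upwards [hC.compl.isOpen.mem_nhds hx] with y hy
      simpa [hx] using hy
  have hf := hlc.prodMk ((isLocallyConstant_entryTime hA hvA).prodMk
    ((isLocallyConstant_entryPoint P.proj_isLocallyConstant hA hvA).prodMk hCl))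
  obtain ⟨Q, hQ⟩ := exists_discreteQuotient_determining_iterates (T := T) hf R
  refine ⟨Q, fun x y hxy => ?_⟩
  have h := hQ _ _ hxy (entryTime T A' x) (hR ⟨x, rfl⟩)
  rw [iterate_entryTime_entryPoint] at h
  simp only [Prod.mk.injEq] at h
  exact ⟨h.1.symm, h.2.1.symm, h.2.2.1.symm, iff_of_eq h.2.2.2.symm⟩

variable [TopologicalSpace.MetrizableSpace X] [TotallyDisconnectedSpace X]

lemma exists_towerSystem {Y : Set X} (hY : IsClosed Y)
    (hsec : ∀ A : Set X, IsClopen A → Y ⊆ A → ∀ x : X, ∃ n : ℤ, (T.toEquiv ^ n) x ∈ A) :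
    ∃ S : TowerSystem T, ⋂ n, S.base n = Y := by
  classical
  let _ := TopologicalSpace.metrizableSpaceMetric X
  have hcount : Countable (TopologicalSpace.Clopens X) :=
    TopologicalSpace.Clopens.countable_iff_secondCountable.2 inferInstance
  obtain ⟨C, hCsurj⟩ := exists_surjective_nat (TopologicalSpace.Clopens X)
  let A : ℕ → Set X := fun n => ⋂ i ∈ Finset.range n, if Y ⊆ C i then (C i : Set X) else Set.univ
  have hYA : ∀ n, Y ⊆ A n := fun n => Set.subset_iInter₂ fun i _ => by
    split_ifs with h
    exacts [h, Set.subset_univ _]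
  have hAclopen : ∀ n, IsClopen (A n) := fun n => isClopen_biInter_finset fun i _ => by
    split_ifs
    exacts [(C i).isClopen, isClopen_univ]
  have hvis : ∀ n x, ∃ m : ℕ, T.symm^[m] x ∈ A n := fun n =>
    exists_iterate_symm_mem (hAclopen n) (hsec _ (hAclopen n) (hYA n))
  choose next hnext using fun n (P : DiscreteQuotient X) =>
    exists_transporting_discreteQuotient (T := T) P (hAclopen n) (hAclopen (n + 1))
      (C n).isClopen (hvis n) (hvis (n + 1))
  refine ⟨{ base := A
            part := fun n => Nat.rec ⊤ next n
            sep := fun n => C n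
            isClopen_base := hAclopen
            base_zero := by simp [A]
            base_succ_subset := fun n => Set.biInter_mono
              (fun i hi => Finset.range_subset_range.2 n.le_succ hi) fun _ _ => subset_rfl
            visits := hvis
            part_zero := rfl
            separates := fun x y h => ?_
            transport := fun n => hnext n _ }, ?_⟩
  · by_contra hne
    obtain ⟨V, hV, hxV, hVy⟩ := compact_exists_isClopen_in_isOpen
      (isOpen_compl_singleton (x := y)) (Set.mem_compl_singleton_iff.2 hne)
    obtain ⟨n, hn⟩ := hCsurj ⟨V, hV⟩
    have h' := h n
    rw [hn] at h'
    exact hVy (h'.1 hxV) rfl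
  · refine Set.Subset.antisymm (fun x hx => ?_) (Set.subset_iInter hYA)
    by_contra hxY
    obtain ⟨V, hV, hxV, hVY⟩ := compact_exists_isClopen_in_isOpen hY.isOpen_compl hxY
    obtain ⟨n, hn⟩ := hCsurj ⟨Vᶜ, hV.compl⟩
    have hmem := Set.mem_iInter₂.1 (Set.mem_iInter.1 hx (n + 1)) n (Finset.self_mem_range_succ n)
    have hsub : Y ⊆ C n := by
      rw [hn]
      exact fun z hz hzV => hVY hzV hz
    rw [if_pos hsub, hn] at hmem
    exact hmem hxV

end Refinement

namespace TowerSystem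

variable {X : Type} [TopologicalSpace X] {T : X ≃ₜ X} (S : TowerSystem T)

/-- The height of `x` above the base of its level `n` tower. -/
noncomputable def time (n : ℕ) (x : X) : ℕ := entryTime T (S.base n) x

/-- The point at the bottom of the level `n` tower, below `x`. -/
noncomputable def point (n : ℕ) (x : X) : X := entryPoint T (S.base n) x

/-- The level `n` tower containing `x`. -/
noncomputable def vtx (n : ℕ) (x : X) : S.part n := (S.part n).proj (S.point n x)

/-- The position, inside its level `n + 1` tower, of the level `n` tower of `x`. -/
noncomputable def pos (n : ℕ) (x : X) : ℕ := S.time (n + 1) (S.point n x)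

/-- The level `n` and `n + 1` towers of `x` and their relative position. -/
noncomputable def edge (n : ℕ) (x : X) : S.part n × S.part (n + 1) × ℕ :=
  (S.vtx n x, S.vtx (n + 1) x, S.pos n x)

lemma edge_eq_iff {n : ℕ} {x z : X} : S.edge n x = S.edge n z ↔
    S.vtx n x = S.vtx n z ∧ S.vtx (n + 1) x = S.vtx (n + 1) z ∧ S.pos n x = S.pos n z := by
  simp [edge]

lemma base_antitone : Antitone S.base := antitone_nat_of_succ_le S.base_succ_subset

lemma time_eq_zero_iff {n : ℕ} {x : X} : S.time n x = 0 ↔ x ∈ S.base n :=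
  entryTime_eq_zero_iff (S.visits n)

lemma time_zero (x : X) : S.time 0 x = 0 := by
  rw [time_eq_zero_iff, S.base_zero]
  exact Set.mem_univ x

lemma point_mem (n : ℕ) (x : X) : S.point n x ∈ S.base n := entryPoint_mem (S.visits n) x

lemma point_of_mem {n : ℕ} {x : X} (h : x ∈ S.base n) : S.point n x = x := entryPoint_of_mem h

lemma point_zero (x : X) : S.point 0 x = x :=
  S.point_of_mem (S.time_eq_zero_iff.1 (S.time_zero x))

lemma point_point (n : ℕ) (x : X) : S.point n (S.point n x) = S.point n x :=
  S.point_of_mem (S.point_mem n x)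

lemma point_succ_point (n : ℕ) (x : X) : S.point (n + 1) (S.point n x) = S.point (n + 1) x :=
  entryPoint_entryPoint (S.visits (n + 1)) (S.base_succ_subset n) x

lemma pos_add_time (n : ℕ) (x : X) : S.pos n x + S.time n x = S.time (n + 1) x :=
  entryTime_entryPoint_add (S.visits (n + 1)) (S.base_succ_subset n) x

lemma iterate_time_point (n : ℕ) (x : X) : T^[S.time n x] (S.point n x) = x :=
  iterate_entryTime_entryPoint x

lemma iterate_pos_point (n : ℕ) (x : X) : T^[S.pos n x] (S.point (n + 1) x) = S.point n x := by
  rw [← point_succ_point, pos, iterate_time_point]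

lemma time_apply_of_notMem {n : ℕ} {x : X} (h : T x ∉ S.base n) :
    S.time n (T x) = S.time n x + 1 :=
  entryTime_apply_of_notMem (S.visits n) h

lemma point_apply_of_notMem {n : ℕ} {x : X} (h : T x ∉ S.base n) :
    S.point n (T x) = S.point n x :=
  entryPoint_apply_of_notMem (S.visits n) h

lemma vtx_point (n : ℕ) (x : X) : S.vtx n (S.point n x) = S.vtx n x := by
  rw [vtx, point_point, vtx]

lemma vtx_succ_point (n : ℕ) (x : X) : S.vtx (n + 1) (S.point n x) = S.vtx (n + 1) x := by
  rw [vtx, point_succ_point, vtx]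

lemma pos_point (n : ℕ) (x : X) : S.pos n (S.point n x) = S.pos n x := by
  rw [pos, point_point, pos]

lemma edge_point (n : ℕ) (x : X) : S.edge n (S.point n x) = S.edge n x := by
  rw [edge_eq_iff, vtx_point, vtx_succ_point, pos_point]
  exact ⟨rfl, rfl, rfl⟩

/-- A point in a given level `n + 1` tower at a prescribed height. -/
lemma exists_eq_iterate_point {n : ℕ} {x z : X} (h : S.vtx (n + 1) z = S.vtx (n + 1) x) :
    ∃ w, w = T^[S.time (n + 1) z] (S.point (n + 1) x) ∧ S.time (n + 1) w = S.time (n + 1) z ∧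
      S.point (n + 1) w = S.point (n + 1) x ∧ S.time n w = S.time n z ∧
      S.vtx n w = S.vtx n z ∧ (w ∈ S.sep n ↔ z ∈ S.sep n) := by
  obtain ⟨h1, h2, h3, h4⟩ := S.transport n z (S.point (n + 1) x) h
  exact ⟨_, rfl, h1, entryPoint_iterate h1, h2, h3, h4⟩

lemma exists_mem_base_eq_iterate {n : ℕ} {x z : X} (h : S.vtx (n + 1) z = S.vtx (n + 1) x) :
    ∃ w ∈ S.base n, w = T^[S.pos n z] (S.point (n + 1) x) ∧ S.time (n + 1) w = S.pos n z ∧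
      S.point (n + 1) w = S.point (n + 1) x ∧ S.vtx n w = S.vtx n z := by
  obtain ⟨w, h1, h2, h3, h4, h5, -⟩ :=
    S.exists_eq_iterate_point ((S.vtx_succ_point n z).trans h)
  refine ⟨w, S.time_eq_zero_iff.1 ?_, h1, h2, h3, h5.trans (S.vtx_point n z)⟩
  rw [h4, time_eq_zero_iff]
  exact S.point_mem n z

lemma vtx_eq_of_pos_eq {n : ℕ} {x z : X} (h : S.vtx (n + 1) z = S.vtx (n + 1) x)
    (hpos : S.pos n z = S.pos n x) : S.vtx n z = S.vtx n x := by
  obtain ⟨w, -, h1, -, -, h2⟩ := S.exists_mem_base_eq_iterate h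
  rw [← h2, h1, hpos, iterate_pos_point, vtx_point]

lemma pos_le_of_le_time {n : ℕ} {x z : X} (h : S.vtx (n + 1) z = S.vtx (n + 1) x)
    (hle : S.pos n z ≤ S.time (n + 1) x) : S.pos n z ≤ S.pos n x := by
  obtain ⟨w, hw, h1, -⟩ := S.exists_mem_base_eq_iterate h
  have hx : T.symm^[S.time (n + 1) x - S.pos n z] x = w := by
    have hx := iterate_symm_iterate_of_le (T := T) (Nat.sub_le (S.time (n + 1) x) (S.pos n z))
      (S.point (n + 1) x)
    rwa [iterate_time_point, Nat.sub_sub_self hle, ← h1] at hx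
  have hle' : S.time n x ≤ S.time (n + 1) x - S.pos n z := entryTime_le (hx ▸ hw)
  have := S.pos_add_time n x
  omega

lemma pos_le_of_apply_mem {n : ℕ} {x z : X} (hx : T x ∈ S.base (n + 1))
    (h : S.vtx (n + 1) z = S.vtx (n + 1) x) : S.pos n z ≤ S.pos n x := by
  refine S.pos_le_of_le_time h (not_lt.1 fun hlt => ?_)
  obtain ⟨w, -, h1, h2, -⟩ := S.exists_mem_base_eq_iterate h
  have hw : T.symm^[S.pos n z - (S.time (n + 1) x + 1)] w = T x := by
    rw [h1, iterate_symm_iterate_of_le (Nat.sub_le _ _), Nat.sub_sub_self hlt,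
      Function.iterate_succ_apply', iterate_time_point]
  have hle : S.time (n + 1) w ≤ S.pos n z - (S.time (n + 1) x + 1) := entryTime_le (hw ▸ hx)
  omega

lemma pos_apply {n : ℕ} {x : X} (h : T x ∈ S.base n) (h' : T x ∉ S.base (n + 1)) :
    S.pos n (T x) = S.time (n + 1) x + 1 := by
  rw [← time_apply_of_notMem S h', ← pos_add_time, S.time_eq_zero_iff.2 h, add_zero]

lemma vtx_apply_of_notMem {n : ℕ} {x : X} (h : T x ∉ S.base n) : S.vtx n (T x) = S.vtx n x := by
  rw [vtx, point_apply_of_notMem S h, vtx]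

lemma pos_lt_pos_apply {n : ℕ} {x : X} (h : T x ∈ S.base n) (h' : T x ∉ S.base (n + 1)) :
    S.pos n x < S.pos n (T x) := by
  rw [S.pos_apply h h', ← pos_add_time]
  omega

lemma edge_apply_of_notMem {n : ℕ} {x : X} (h : T x ∉ S.base n) :
    S.edge n (T x) = S.edge n x := by
  have h' : T x ∉ S.base (n + 1) := fun hx => h (S.base_succ_subset n hx)
  rw [edge_eq_iff, pos, S.point_apply_of_notMem h, S.vtx_apply_of_notMem h,
    S.vtx_apply_of_notMem h']
  exact ⟨rfl, rfl, rfl⟩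

lemma eq_of_forall_edge_eq {x z : X} (h : ∀ n, S.edge n x = S.edge n z) : x = z := by
  have htime : ∀ n, S.time n x = S.time n z := fun n => by
    induction n with
    | zero => rw [time_zero, time_zero]
    | succ n ih => rw [← pos_add_time, ← pos_add_time, ih, (S.edge_eq_iff.1 (h n)).2.2]
  refine S.separates x z fun n => ?_
  obtain ⟨w, h1, -, -, -, -, h2⟩ := S.exists_eq_iterate_point (S.edge_eq_iff.1 (h n)).2.1
  rw [htime, iterate_time_point] at h1
  rw [← h2, h1]

/-- Compatible finite sequences of edges are realized above every point of the top tower. -/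
lemma exists_point_eq_of_compatible (z : ℕ → X)
    (hz : ∀ n, S.vtx (n + 1) (z n) = S.vtx (n + 1) (z (n + 1))) (N : ℕ) (y : X)
    (hy : y ∈ S.base N) (hvy : S.vtx N y = S.vtx N (z N)) :
    ∃ x, S.point N x = y ∧ ∀ i < N, S.edge i x = S.edge i (z i) := by
  induction N generalizing y with
  | zero => exact ⟨y, S.point_zero y, fun i hi => absurd hi (Nat.not_lt_zero i)⟩
  | succ N ih =>
    have hv : S.vtx (N + 1) (z N) = S.vtx (N + 1) y := (hz N).trans hvy.symm
    obtain ⟨w, hw, -, h2, h3, h4⟩ := S.exists_mem_base_eq_iterate hv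
    obtain ⟨x, hx, hedge⟩ := ih w hw h4
    refine ⟨x, ?_, fun i hi => ?_⟩
    · rw [← point_succ_point, hx, h3, S.point_of_mem hy]
    · rcases Nat.lt_succ_iff_lt_or_eq.1 hi with hlt | rfl
      · exact hedge i hlt
      · rw [← edge_point, hx, edge_eq_iff]
        refine ⟨h4, ?_, ?_⟩
        · rw [vtx, h3, hv, vtx]
        · rw [pos, S.point_of_mem hw, h2]

section Topology

lemma isLocallyConstant_vtx (n : ℕ) : IsLocallyConstant (S.vtx n) :=
  isLocallyConstant_entryPoint (S.part n).proj_isLocallyConstant (S.isClopen_base n) (S.visits n)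

lemma isLocallyConstant_edge (n : ℕ) : IsLocallyConstant (S.edge n) :=
  (S.isLocallyConstant_vtx n).prodMk ((S.isLocallyConstant_vtx (n + 1)).prodMk
    (isLocallyConstant_entryPoint
      (isLocallyConstant_entryTime (S.isClopen_base (n + 1)) (S.visits (n + 1)))
      (S.isClopen_base n) (S.visits n)))

lemma exists_forall_edge_eq [CompactSpace X] (z : ℕ → X)
    (hz : ∀ n, S.vtx (n + 1) (z n) = S.vtx (n + 1) (z (n + 1))) :
    ∃ x, ∀ n, S.edge n x = S.edge n (z n) := by
  have hclosed : ∀ N, IsClosed { x | ∀ i < N, S.edge i x = S.edge i (z i) } := fun N => by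
    simp only [Set.ofPred_forall]
    exact isClosed_iInter fun i => isClosed_iInter fun _ =>
      (S.isLocallyConstant_edge i).isClosed_fiber _
  obtain ⟨x, hx⟩ := IsCompact.nonempty_iInter_of_sequence_nonempty_isCompact_isClosed
    (fun N => { x | ∀ i < N, S.edge i x = S.edge i (z i) })
    (fun N x hx i hi => hx i (hi.trans N.lt_succ_self))
    (fun N => by
      obtain ⟨x, -, hx⟩ := S.exists_point_eq_of_compatible z hz N (S.point N (z N))
        (S.point_mem N _) (S.vtx_point N _)
      exact ⟨x, hx⟩)
    (hclosed 0).isCompact hclosed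
  exact ⟨x, fun n => Set.mem_iInter.1 hx (n + 1) n n.lt_succ_self⟩

end Topology

section Diagram

variable [CompactSpace X] [Nonempty X]

open BratteliDiagram

/-- The Bratteli diagram of a tower system. -/
noncomputable def diagram : BratteliDiagram where
  V n := Set.range (S.vtx n)
  E n := Set.range (S.edge n)
  fintypeV n := (S.isLocallyConstant_vtx n).range_finite.fintype
  fintypeE n := (S.isLocallyConstant_edge n).range_finite.fintype
  nonemptyV n := (Set.range_nonempty _).to_subtype
  nonemptyE n := (Set.range_nonempty _).to_subtype
  root_subsingleton v w := by
    have h : ∀ a b : S.part 0, a = b := by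
      rw [S.part_zero]
      exact fun a b => Subsingleton.elim a b
    exact Subtype.ext (h _ _)
  src n e := ⟨e.1.1, by obtain ⟨_, x, rfl⟩ := e; exact ⟨x, rfl⟩⟩
  rng n e := ⟨e.1.2.1, by obtain ⟨_, x, rfl⟩ := e; exact ⟨x, rfl⟩⟩
  src_surj n := by
    rintro ⟨_, x, rfl⟩
    exact ⟨⟨_, x, rfl⟩, rfl⟩
  rng_surj n := by
    rintro ⟨_, x, rfl⟩
    exact ⟨⟨_, x, rfl⟩, rfl⟩

/-- Edges with the same range are ordered by their position in the tower. -/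
noncomputable def order : S.diagram.OrderOn := fun n v =>
  LinearOrder.lift' (fun e : { e : S.diagram.E n // S.diagram.rng n e = v } => e.1.1.2.2) <| by
    rintro ⟨⟨_, x, rfl⟩, hx⟩ ⟨⟨_, z, rfl⟩, hz⟩ (hpos : S.pos n x = S.pos n z)
    have hv : S.vtx (n + 1) x = S.vtx (n + 1) z := congrArg Subtype.val (hx.trans hz.symm)
    exact Subtype.ext (Subtype.ext (S.edge_eq_iff.2 ⟨S.vtx_eq_of_pos_eq hv hpos, hv, hpos⟩))

/-- The path of towers through `x`. -/
noncomputable def path (x : X) : S.diagram.PathSpace :=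
  ⟨fun n => ⟨S.edge n x, x, rfl⟩, fun _ => rfl⟩

lemma path_apply_eq_iff {n : ℕ} {x z : X} :
    (S.path x).1 n = (S.path z).1 n ↔ S.edge n x = S.edge n z :=
  Subtype.ext_iff

lemma isMaxEdge_path_iff_forall {n : ℕ} {x : X} : IsMaxEdge S.order ((S.path x).1 n) ↔
    ∀ z, S.vtx (n + 1) z = S.vtx (n + 1) x → S.pos n z ≤ S.pos n x := by
  constructor
  · exact fun h z hz => h ⟨(S.path z).1 n, Subtype.ext hz⟩
  · rintro h ⟨⟨_, z, rfl⟩, hz⟩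
    exact h z (congrArg Subtype.val hz)

lemma isMinEdge_path_iff_forall {n : ℕ} {x : X} : IsMinEdge S.order ((S.path x).1 n) ↔
    ∀ z, S.vtx (n + 1) z = S.vtx (n + 1) x → S.pos n x ≤ S.pos n z := by
  constructor
  · exact fun h z hz => h ⟨(S.path z).1 n, Subtype.ext hz⟩
  · rintro h ⟨⟨_, z, rfl⟩, hz⟩
    exact h z (congrArg Subtype.val hz)

lemma isMinEdge_path_iff {n : ℕ} {x : X} :
    IsMinEdge S.order ((S.path x).1 n) ↔ S.pos n x = 0 := by
  rw [isMinEdge_path_iff_forall]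
  refine ⟨fun h => ?_, fun h z _ => h ▸ Nat.zero_le _⟩
  have h1 := h _ (S.vtx_point (n + 1) x)
  have h2 := S.pos_add_time n (S.point (n + 1) x)
  rw [S.time_eq_zero_iff.2 (S.point_mem (n + 1) x)] at h2
  omega

lemma isMaxEdge_path_iff {n : ℕ} {x : X} (hx : T x ∈ S.base n) :
    IsMaxEdge S.order ((S.path x).1 n) ↔ T x ∈ S.base (n + 1) := by
  rw [isMaxEdge_path_iff_forall]
  refine ⟨fun h => ?_, fun h z => S.pos_le_of_apply_mem h⟩
  by_contra h'
  exact absurd (h _ (S.vtx_apply_of_notMem h')) (not_le.2 (S.pos_lt_pos_apply hx h'))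

lemma isSuccEdge_path_apply {n : ℕ} {x : X} (h : T x ∈ S.base n) (h' : T x ∉ S.base (n + 1)) :
    IsSuccEdge S.order ((S.path x).1 n) ((S.path (T x)).1 n) := by
  refine ⟨Subtype.ext (S.vtx_apply_of_notMem h'), S.pos_lt_pos_apply h h', ?_⟩
  rintro ⟨⟨_, z, rfl⟩, hz⟩ (hlt : S.pos n x < S.pos n z)
  change S.pos n (T x) ≤ S.pos n z
  rw [S.pos_apply h h']
  by_contra hle
  exact absurd (S.pos_le_of_le_time (congrArg Subtype.val hz) (by omega)) (not_le.2 hlt)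

lemma apply_mem_base_of_isMaxEdge {x : X} (n : ℕ)
    (h : ∀ i < n, IsMaxEdge S.order ((S.path x).1 i)) : T x ∈ S.base n := by
  induction n with
  | zero => rw [S.base_zero]; exact Set.mem_univ _
  | succ n ih =>
    exact (S.isMaxEdge_path_iff (ih fun i hi => h i (hi.trans n.lt_succ_self))).1
      (h n n.lt_succ_self)

lemma isMaxPath_path_iff {x : X} : IsMaxPath S.order (S.path x) ↔ T x ∈ ⋂ n, S.base n := by
  rw [Set.mem_iInter]
  exact ⟨fun h n => S.apply_mem_base_of_isMaxEdge n fun i _ => h i,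
    fun h n => (S.isMaxEdge_path_iff (h n)).2 (h (n + 1))⟩

lemma isMinPath_path_iff {x : X} : IsMinPath S.order (S.path x) ↔ x ∈ ⋂ n, S.base n := by
  simp only [IsMinPath, isMinEdge_path_iff, Set.mem_iInter, ← time_eq_zero_iff]
  constructor
  · intro h n
    induction n with
    | zero => exact S.time_zero x
    | succ n ih => rw [← pos_add_time, h, ih]
  · intro h n
    have := S.pos_add_time n x
    rw [h (n + 1)] at this
    omega

lemma path_injective : Function.Injective S.path := fun _ _ h =>
  S.eq_of_forall_edge_eq fun n => S.path_apply_eq_iff.1 (congrFun (congrArg Subtype.val h) n)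

lemma path_surjective : Function.Surjective S.path := by
  rintro ⟨w, hw⟩
  choose z hz using fun n => (w n).2
  obtain ⟨x, hx⟩ := S.exists_forall_edge_eq z fun n => by
    have h : (w n).1.2.1 = (w (n + 1)).1.1 := congrArg Subtype.val (hw n)
    rwa [← hz, ← hz] at h
  exact ⟨x, Subtype.ext (funext fun n => Subtype.ext ((hx n).trans (hz n)))⟩

instance (B : BratteliDiagram) (n : ℕ) : DiscreteTopology (B.E n) := ⟨rfl⟩

instance (B : BratteliDiagram) : T2Space B.PathSpace := by
  unfold BratteliDiagram.PathSpace
  infer_instance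

lemma continuous_path : Continuous S.path := by
  refine Continuous.subtype_mk (continuous_pi fun n => ?_) _
  have h : IsLocallyConstant fun x => (S.path x).1 n :=
    (IsLocallyConstant.iff_eventually_eq _).2 fun x =>
      ((S.isLocallyConstant_edge n).eventually_eq x).mono fun _ hy => Subtype.ext hy
  exact h.continuous

/-- The homeomorphism from the space to the path space of the diagram. -/
noncomputable def pathHomeomorph : X ≃ₜ S.diagram.PathSpace :=
  Continuous.homeoOfEquivCompactToT2
    (f := Equiv.ofBijective S.path ⟨S.path_injective, S.path_surjective⟩) S.continuous_path

/-- The homeomorphism of the path space conjugate to `T`. -/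
noncomputable def vershik : S.diagram.PathSpace ≃ₜ S.diagram.PathSpace :=
  (S.pathHomeomorph.symm.trans T).trans S.pathHomeomorph

lemma vershik_path (x : X) : S.vershik (S.path x) = S.path (T x) := by
  change S.path (T (S.pathHomeomorph.symm (S.pathHomeomorph x))) = _
  rw [Homeomorph.symm_apply_apply]

lemma isVershikMap_vershik : IsVershikMap S.order S.vershik := by
  refine ⟨Set.ext fun p => ?_, fun p hp => ?_⟩
  · constructor
    · rintro ⟨q, hq, rfl⟩
      obtain ⟨x, rfl⟩ := S.path_surjective q
      change IsMinPath S.order (S.vershik (S.path x))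
      rw [vershik_path, isMinPath_path_iff]
      exact S.isMaxPath_path_iff.1 hq
    · intro hp
      obtain ⟨x, rfl⟩ := S.path_surjective p
      obtain ⟨y, rfl⟩ := T.surjective x
      exact ⟨S.path y, S.isMaxPath_path_iff.2 (S.isMinPath_path_iff.1 hp), S.vershik_path y⟩
  · classical
    obtain ⟨x, rfl⟩ := S.path_surjective p
    have hex : ∃ k, ¬IsMaxEdge S.order ((S.path x).1 k) := not_forall.1 hp
    let k := Nat.find hex
    have hlt : ∀ i < k, IsMaxEdge S.order ((S.path x).1 i) :=
      fun i hi => not_not.1 (Nat.find_min hex hi)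
    have hk : ¬IsMaxEdge S.order ((S.path x).1 k) := Nat.find_spec hex
    have hmem := S.apply_mem_base_of_isMaxEdge k hlt
    have hnot : T x ∉ S.base (k + 1) := fun h => hk ((S.isMaxEdge_path_iff hmem).2 h)
    rw [vershik_path]
    refine ⟨k, hlt, hk, S.isSuccEdge_path_apply hmem hnot, fun i hi => ?_, fun i hi => ?_⟩
    · rw [isMinEdge_path_iff]
      have h := S.pos_add_time i (T x)
      rw [S.time_eq_zero_iff.2 (S.base_antitone hi hmem)] at h
      omega
    · exact S.path_apply_eq_iff.2
        (S.edge_apply_of_notMem fun h => hnot (S.base_antitone hi h))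

end Diagram

end TowerSystem

open BratteliDiagram in
/-- **Bratteli–Vershik model for aperiodic Cantor systems (Medynets).** Given an aperiodic
Cantor system `(X, T)` with basic set `Y`, there are an ordered Bratteli diagram `(B, ω)`
with perfect order, a Vershik map `φ_ω`, and a conjugating homeomorphism `h : X → X_B`
with `h ∘ T = φ_ω ∘ h` and `h(Y) = X_min(ω)`. -/
theorem exists_BratteliVershik_model
    (X : Type) [TopologicalSpace X] [CompactSpace X]
    [TopologicalSpace.MetrizableSpace X] [TotallyDisconnectedSpace X]
    [PerfectSpace X] [Nonempty X]
    (T : X ≃ₜ X)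
    (haper : ∀ x : X, (Set.range fun n : ℤ => (T.toEquiv ^ n) x).Infinite)
    (Y : Set X) (hYne : Y.Nonempty) (hYclosed : IsClosed Y)
    (hYdisj : ∀ i : ℤ, i ≠ 0 → Y ∩ ((T.toEquiv ^ i : Equiv.Perm X) '' Y) = ∅)
    (hYsection : ∀ A : Set X, IsClopen A → Y ⊆ A →
      ∀ x : X, ∃ n : ℤ, (T.toEquiv ^ n) x ∈ A) :
    ∃ (B : BratteliDiagram) (ω : B.OrderOn) (φ : B.PathSpace ≃ₜ B.PathSpace),
      IsVershikMap ω φ ∧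
      ∃ h : X ≃ₜ B.PathSpace,
        (∀ x : X, h (T x) = φ (h x)) ∧
        (h : X → B.PathSpace) '' Y = { x : B.PathSpace | IsMinPath ω x } := by
  obtain ⟨S, hS⟩ := exists_towerSystem hYclosed hYsection
  refine ⟨S.diagram, S.order, S.vershik, S.isVershikMap_vershik, S.pathHomeomorph,
    fun x => (S.vershik_path x).symm, Set.ext fun p => ?_⟩
  obtain ⟨x, rfl⟩ := S.path_surjective p
  change S.path x ∈ S.path '' Y ↔ IsMinPath S.order (S.path x)
  rw [S.path_injective.mem_set_image, S.isMinPath_path_iff, hS]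
end
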